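/- (Lemma 2.1, condition SI-1 for S(n)) Let n ≥ 2. The smallest Lie subalgebra of W(n) containing S(n)_{[−1]} ∪ S(n)_{[0]} ∪ S(n)_{[1]} is S(n); that is, the special algebra S(n) is generated as a Lie algebra by its homogeneous components of degrees −1, 0 and 1. -/

import Mathlib

open MvPolynomial

noncomputable section

abbrev Wn (F : Type*) [Field F] (n : ℕ) :=
  Derivation F (MvPolynomial (Fin n) F) (MvPolynomial (Fin n) F)

/-- The submodule of polynomials homogeneous of integer degree `d`
(for `d < 0` this is `⊥`). -/
def homZ (F : Type*) [Field F] (n : ℕ) (d : ℤ) : Submodule F (MvPolynomial (Fin n) F) where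
  carrier := {p | ∀ m : Fin n →₀ ℕ, coeff m p ≠ 0 → (m.sum fun _ e => (e : ℤ)) = d}
  zero_mem' := by intro m hm; simp at hm
  add_mem' := by
    intro p q hp hq m hm
    by_cases h : coeff m p = 0
    · refine hq m fun hq0 => hm ?_
      simp [coeff_add, h, hq0]
    · exact hp m h
  smul_mem' := by
    intro c p hp m hm
    refine hp m fun h => hm ?_
    simp [coeff_smul, h]

/-- The homogeneous component `W(n)_{[i]}`. -/
def Wgr (F : Type*) [Field F] (n : ℕ) (i : ℤ) : Submodule F (Wn F n) where
  carrier := {D | ∀ k, D (X k) ∈ homZ F n (i + 1)}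
  zero_mem' := by intro k; simp
  add_mem' := by intro D E hD hE k; simpa using add_mem (hD k) (hE k)
  smul_mem' := by intro c D hD k; simpa using Submodule.smul_mem _ c (hD k)


/-- The divergence of a polynomial vector field. -/
def divg {F : Type*} [Field F] {n : ℕ} (D : Wn F n) : MvPolynomial (Fin n) F :=
  ∑ i, pderiv i (D (X i))

/-- The homogeneous component `S(n)_{[i]} = S(n) ∩ W(n)_{[i]}`. -/
def Sgr (F : Type*) [Field F] (n : ℕ) (i : ℤ) : Set (Wn F n) :=
  {D | divg D = 0} ∩ (Wgr F n i : Set (Wn F n))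

theorem mem_homZ_of_isHomogeneous {F : Type*} [Field F] {n d : ℕ} {p : MvPolynomial (Fin n) F}
    (hp : p.IsHomogeneous d) : p ∈ homZ F n d := by
  intro m hm
  have h : m.degree = d := by
    rw [Finsupp.degree_eq_weight_one]
    exact hp hm
  rw [← h, Finsupp.degree_apply, Finsupp.sum]
  push_cast
  rfl

section Hamiltonian

variable {F : Type*} [Field F] {n : ℕ}

theorem pderiv_comm (i j : Fin n) (p : MvPolynomial (Fin n) F) :
    pderiv i (pderiv j p) = pderiv j (pderiv i p) := by
  ext m
  simp only [coeff_pderiv, Finsupp.add_apply, Finsupp.single_apply, add_right_comm m]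
  by_cases h : i = j
  · subst h; ring
  · simp only [h, Ne.symm h, if_false]
    push_cast
    ring

theorem derivation_sum_apply {ι : Type*} (s : Finset ι) (D : ι → Wn F n)
    (p : MvPolynomial (Fin n) F) : (∑ i ∈ s, D i) p = ∑ i ∈ s, D i p := by
  induction s using Finset.cons_induction with
  | empty => simp
  | cons a s ha ih => simp [Finset.sum_cons, ih]

theorem derivation_apply_eq_sum (D : Wn F n) (p : MvPolynomial (Fin n) F) :
    D p = ∑ k, D (X k) * pderiv k p := by
  have h : D = ∑ k, D (X k) • (pderiv k : Wn F n) := by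
    ext1 l
    simp [derivation_sum_apply, Pi.single_apply]
  conv_lhs => rw [h]
  simp [derivation_sum_apply]

theorem divg_lie (D E : Wn F n) : divg ⁅D, E⁆ = D (divg E) - E (divg D) := by
  have key (D E : Wn F n) : ∑ i, pderiv i (D (E (X i))) =
      ∑ i, ∑ k, pderiv i (D (X k)) * pderiv k (E (X i)) + D (divg E) := by
    rw [divg, map_sum, ← Finset.sum_add_distrib]
    refine Finset.sum_congr rfl fun i _ => ?_
    rw [derivation_apply_eq_sum D, derivation_apply_eq_sum D, map_sum, ← Finset.sum_add_distrib]
    refine Finset.sum_congr rfl fun k _ => ?_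
    rw [pderiv_mul, pderiv_comm i k]
  have swap : ∑ i, ∑ k, pderiv i (D (X k)) * pderiv k (E (X i)) =
      ∑ i, ∑ k, pderiv i (E (X k)) * pderiv k (D (X i)) := by
    rw [Finset.sum_comm]
    exact Finset.sum_congr rfl fun i _ => Finset.sum_congr rfl fun k _ => mul_comm _ _
  rw [divg]
  simp only [Derivation.commutator_apply, map_sub, Finset.sum_sub_distrib]
  rw [key D E, key E D, swap]
  ring

variable (F n) in
/-- The special algebra `S(n)` as a Lie subalgebra of `W(n)`. -/
def specialSubalgebra : LieSubalgebra F (Wn F n) where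
  carrier := {D | divg D = 0}
  zero_mem' := by simp [divg]
  add_mem' := by
    intro D E hD hE
    simp only [Set.mem_ofPred_eq, divg] at hD hE ⊢
    simp [Finset.sum_add_distrib, hD, hE]
  smul_mem' := by
    intro c D hD
    simp only [Set.mem_ofPred_eq, divg] at hD ⊢
    simp [← Finset.smul_sum, hD]
  lie_mem' := by
    intro D E hD hE
    simp [Set.mem_ofPred_eq, divg_lie, show divg D = 0 from hD, show divg E = 0 from hE]

/-- The Hamiltonian vector field `∂ⱼ(f) ∂ᵢ - ∂ᵢ(f) ∂ⱼ` of `f` in the variables `xᵢ, xⱼ`. -/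
def ham (i j : Fin n) : MvPolynomial (Fin n) F →ₗ[F] Wn F n where
  toFun f := pderiv j f • (pderiv i : Wn F n) - pderiv i f • (pderiv j : Wn F n)
  map_add' f g := by
    simp only [map_add, add_smul]
    abel
  map_smul' c f := by
    simp only [Derivation.map_smul, smul_assoc, smul_sub, RingHom.id_apply]

theorem ham_apply (i j : Fin n) (f p : MvPolynomial (Fin n) F) :
    ham i j f p = pderiv j f * pderiv i p - pderiv i f * pderiv j p := rfl

theorem ham_swap (i j : Fin n) (f : MvPolynomial (Fin n) F) : ham j i f = -ham i j f := by
  ext1 k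
  simp only [ham_apply, Derivation.neg_apply]
  ring

theorem lie_ham (i j : Fin n) (f g : MvPolynomial (Fin n) F) :
    ⁅ham i j f, ham i j g⁆ = ham i j (ham i j f g) := by
  refine Derivation.ext fun p => ?_
  simp only [Derivation.commutator_apply, ham_apply, LinearMap.map_sub, Derivation.sub_apply,
    Derivation.map_sub, pderiv_mul]
  rw [pderiv_comm j i f, pderiv_comm j i g, pderiv_comm j i p]
  ring

theorem divg_ham (i j : Fin n) (f : MvPolynomial (Fin n) F) : divg (ham i j f) = 0 := by
  simp only [divg, ham_apply, pderiv_X, map_sub, Finset.sum_sub_distrib]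
  have h (a b : Fin n) : ∑ k, pderiv k (pderiv a f * Pi.single (M := fun _ => MvPolynomial (Fin n) F) b 1 k) =
      pderiv b (pderiv a f) := by
    simp [Pi.single_apply, apply_ite]
  rw [h, h, pderiv_comm, sub_self]

theorem ham_mem_Wgr (i j : Fin n) {d : ℕ} {f : MvPolynomial (Fin n) F}
    (hf : f.IsHomogeneous (d + 1)) : ham i j f ∈ Wgr F n (d - 1) := by
  intro k
  rw [sub_add_cancel]
  apply mem_homZ_of_isHomogeneous
  have hX (a b : Fin n) :
      (Pi.single (M := fun _ => MvPolynomial (Fin n) F) a 1 b).IsHomogeneous 0 := by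
    rw [Pi.single_apply]
    split_ifs
    exacts [isHomogeneous_one _ _, isHomogeneous_zero _ _ _]
  rw [ham_apply, pderiv_X, pderiv_X]
  exact (hf.pderiv.mul (hX i k)).sub (hf.pderiv.mul (hX j k))

theorem monomial_single_add_single_add (a b : Fin n) (m : Fin n →₀ ℕ) :
    monomial (Finsupp.single a 1 + Finsupp.single b 1 + m) (1 : F) =
      X a * X b * monomial m 1 := by
  simp [X, monomial_mul]

end Hamiltonian

section Generation

variable {F : Type*} [Field F] [CharZero F] {n : ℕ} {L : LieSubalgebra F (Wn F n)}

theorem ham_mem_of_factor {i j k : Fin n} (hij : i ≠ j) (hkj : k ≠ j) {m : Fin n →₀ ℕ}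
    (hcubic : ham i j (X i ^ 2 * X k) ∈ L) (hm : ham i j (X j * monomial m 1) ∈ L) :
    ham i j (X i * X k * monomial m 1) ∈ L := by
  obtain ⟨c, hc, hic⟩ : ∃ c : F, c ≠ 0 ∧
      pderiv i (X i ^ 2 * X k : MvPolynomial (Fin n) F) = C c * (X i * X k) := by
    by_cases hki : k = i
    · subst hki
      refine ⟨3, by norm_num, ?_⟩
      simp only [pderiv_mul, pderiv_pow, pderiv_X_self, map_ofNat]
      push_cast
      ring
    · refine ⟨2, by norm_num, ?_⟩
      simp only [pderiv_mul, pderiv_pow, pderiv_X_self, pderiv_X_of_ne hki, map_ofNat]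
      push_cast
      ring
  have hjc : pderiv j (X i ^ 2 * X k : MvPolynomial (Fin n) F) = 0 := by
    simp [pderiv_X_of_ne hkj, pderiv_X_of_ne hij]
  have hjm : pderiv j (X j * monomial m 1 : MvPolynomial (Fin n) F) =
      C ((m j : F) + 1) * monomial m 1 := by
    rw [pderiv_mul, X_mul_pderiv_monomial, pderiv_X_self, nsmul_eq_mul]
    simp only [map_add, map_natCast, map_one]
    ring
  have h := L.lie_mem hcubic hm
  rw [lie_ham, ham_apply, hic, hjc, hjm] at h
  have hne : -(c * ((m j : F) + 1)) ≠ 0 := neg_ne_zero.2 (mul_ne_zero hc (Nat.cast_add_one_ne_zero _))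
  have e : (0 * pderiv i (X j * monomial m 1) -
      C c * (X i * X k) * (C ((m j : F) + 1) * monomial m 1) : MvPolynomial (Fin n) F) =
      (-(c * ((m j : F) + 1))) • (X i * X k * monomial m 1) := by
    rw [smul_eq_C_mul]
    simp only [map_neg, map_mul]
    ring
  rw [e, map_smul] at h
  simpa only [inv_smul_smul₀ hne] using L.smul_mem (-(c * ((m j : F) + 1)))⁻¹ h

theorem exists_factor {i j : Fin n} (hij : i ≠ j) {m : Fin n →₀ ℕ} (hm : 3 < m.degree)
    (h : m i ≠ 0) :
    (∃ k ≠ j, ∃ m', m = Finsupp.single i 1 + Finsupp.single k 1 + m') ∨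
    ∃ m', m = Finsupp.single j 1 + Finsupp.single j 1 + m' := by
  by_cases hk : ∃ k ≠ j, Finsupp.single i 1 + Finsupp.single k 1 ≤ m
  · obtain ⟨k, hkj, hk⟩ := hk
    exact Or.inl ⟨k, hkj, le_iff_exists_add.1 hk⟩
  · refine Or.inr (le_iff_exists_add.1 ?_)
    push Not at hk
    have hi : m i = 1 := by
      by_contra hi
      refine hk i hij fun l => ?_
      simp only [Finsupp.add_apply, Finsupp.single_apply]
      split_ifs with hl <;> [(subst hl; omega); omega]
    have hrest (k : Fin n) (hki : k ≠ i) (hkj : k ≠ j) : m k = 0 := by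
      by_contra hmk
      refine hk k hkj fun l => ?_
      simp only [Finsupp.add_apply, Finsupp.single_apply]
      by_cases h1 : i = l
      · subst h1; simp [hki]; omega
      · by_cases h2 : k = l
        · subst h2; simp [h1]; omega
        · simp [h1, h2]
    have hdeg : m.degree = m i + m j := by
      rw [Finsupp.degree_eq_sum]
      exact Finset.sum_eq_add i j hij (fun k _ hk => hrest k hk.1 hk.2) (by simp) (by simp)
    intro l
    simp only [Finsupp.add_apply, Finsupp.single_apply]
    split_ifs with hl <;> [(subst hl; omega); omega]

theorem ham_monomial_mem (hL : ∀ (i j : Fin n) (m : Fin n →₀ ℕ), m.degree ≤ 3 →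
    ham i j (monomial m (1 : F)) ∈ L) {i j : Fin n} (hij : i ≠ j) (m : Fin n →₀ ℕ) :
    ham i j (monomial m (1 : F)) ∈ L := by
  induction hd : m.degree using Nat.strong_induction_on generalizing m with
  | _ d ih =>
  by_cases hd3 : d ≤ 3
  · exact hL i j m (hd ▸ hd3)
  have hcubic (a b k : Fin n) : ham a b (X a ^ 2 * X k : MvPolynomial (Fin n) F) ∈ L := by
    have e : (X a ^ 2 * X k : MvPolynomial (Fin n) F) =
        monomial (Finsupp.single a 1 + Finsupp.single a 1 + Finsupp.single k 1) 1 := by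
      rw [monomial_single_add_single_add, sq]; rfl
    rw [e]
    exact hL a b _ (by simp [Finsupp.degree_single])
  have hlow (a b k : Fin n) (m' : Fin n →₀ ℕ)
      (hm' : m = Finsupp.single a 1 + Finsupp.single b 1 + m') :
      ham i j (X k * monomial m' (1 : F)) ∈ L := by
    have e : (X k * monomial m' (1 : F)) = monomial (Finsupp.single k 1 + m') 1 := by
      simp [X, monomial_mul]
    rw [e]
    refine ih _ ?_ _ rfl
    rw [← hd, hm']
    simp [Finsupp.degree_single]
  have hfst (k : Fin n) (hk : k ≠ j) (m' : Fin n →₀ ℕ)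
      (hm' : m = Finsupp.single i 1 + Finsupp.single k 1 + m') :
      ham i j (monomial m (1 : F)) ∈ L := by
    rw [hm', monomial_single_add_single_add]
    exact ham_mem_of_factor hij hk (hcubic i j k) (hlow i k j m' hm')
  have hsnd (k : Fin n) (hk : k ≠ i) (m' : Fin n →₀ ℕ)
      (hm' : m = Finsupp.single j 1 + Finsupp.single k 1 + m') :
      ham i j (monomial m (1 : F)) ∈ L := by
    rw [hm', monomial_single_add_single_add, ham_swap]
    refine neg_mem (ham_mem_of_factor hij.symm hk (hcubic j i k) ?_)
    rw [ham_swap]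
    exact neg_mem (hlow j k i m' hm')
  have hm3 : 3 < m.degree := by omega
  by_cases hi : m i = 0
  · by_cases hj : m j = 0
    · have : ham i j (monomial m (1 : F)) = 0 := by
        ext1 k
        simp [ham_apply, hi, hj]
      rw [this]
      exact L.zero_mem
    · rcases exists_factor hij.symm hm3 hj with ⟨k, hk, m', hm'⟩ | ⟨m', hm'⟩
      · exact hsnd k hk m' hm'
      · exact hfst i hij m' hm'
  · rcases exists_factor hij hm3 hi with ⟨k, hk, m', hm'⟩ | ⟨m', hm'⟩
    · exact hfst k hk m' hm'
    · exact hsnd j hij.symm m' hm'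

theorem ham_mem (hL : ∀ (i j : Fin n) (m : Fin n →₀ ℕ), m.degree ≤ 3 →
    ham i j (monomial m (1 : F)) ∈ L) (i j : Fin n) (f : MvPolynomial (Fin n) F) :
    ham i j f ∈ L := by
  by_cases hij : i = j
  · subst hij
    have : ham i i f = 0 := by
      ext1 k
      simp [ham_apply]
    rw [this]
    exact L.zero_mem
  · rw [f.as_sum, map_sum]
    refine sum_mem fun m _ => ?_
    rw [← mul_one (coeff m f), ← smul_eq_mul, ← smul_monomial, map_smul]
    exact L.smul_mem _ (ham_monomial_mem hL hij m)

end Generation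

section Decomposition

variable {F : Type*} [Field F] {n : ℕ}

theorem pderiv_homogeneousComponent_succ (i : Fin n) (d : ℕ) (f : MvPolynomial (Fin n) F) :
    pderiv i (homogeneousComponent (d + 1) f) = homogeneousComponent d (pderiv i f) := by
  ext m
  simp [coeff_pderiv, coeff_homogeneousComponent, Finsupp.degree_single]

theorem sum_ham_X_mul {d : ℕ} {D : Wn F n} (hD : ∀ k, (D (X k)).IsHomogeneous d)
    (hdiv : divg D = 0) :
    ∑ i, ∑ j, ham i j (X j * D (X i)) = ((n : F) + d - 1) • D := by
  ext1 k
  have h1 : ∑ j, pderiv j (X j * D (X k)) = ((n : F) + d) • D (X k) := by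
    simp only [pderiv_mul, pderiv_X_self, one_mul, Finset.sum_add_distrib,
      (hD k).sum_X_mul_pderiv]
    simp [add_smul, Nat.cast_smul_eq_nsmul]
  have h2 : ∑ i, pderiv i (X k * D (X i)) = D (X k) := by
    simp only [pderiv_mul, Finset.sum_add_distrib, ← Finset.mul_sum]
    rw [show ∑ i, pderiv i (D (X i)) = 0 from hdiv]
    simp [Pi.single_apply]
  calc _ = ∑ j, pderiv j (X j * D (X k)) - ∑ i, pderiv i (X k * D (X i)) := by
        simp [derivation_sum_apply, ham_apply, -Derivation.leibniz, Pi.single_apply,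
          Finset.sum_sub_distrib]
    _ = _ := by rw [h1, h2, Derivation.smul_apply, sub_smul, one_smul]

/-- The derivation whose coefficients are the degree `d` parts of those of `D`. -/
def homPart (d : ℕ) (D : Wn F n) : Wn F n :=
  mkDerivation F fun k => homogeneousComponent d (D (X k))

theorem homPart_X (d : ℕ) (D : Wn F n) (k : Fin n) :
    homPart d D (X k) = homogeneousComponent d (D (X k)) :=
  mkDerivation_X _ _ _

theorem divg_homPart (d : ℕ) {D : Wn F n} (hD : divg D = 0) : divg (homPart d D) = 0 := by
  simp only [divg, homPart_X]
  cases d with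
  | zero => simp [homogeneousComponent_zero]
  | succ d =>
    simp only [pderiv_homogeneousComponent_succ, ← map_sum]
    rw [show ∑ i, pderiv i (D (X i)) = 0 from hD, map_zero]

theorem exists_sum_homPart (D : Wn F n) : ∃ M, D = ∑ d ∈ Finset.range M, homPart d D := by
  refine ⟨∑ k, ((D (X k)).totalDegree + 1), ?_⟩
  ext1 k
  simp only [derivation_sum_apply, homPart_X]
  conv_lhs => rw [← sum_homogeneousComponent (D (X k))]
  refine Finset.sum_subset (Finset.range_subset_range.2 ?_) fun d _ hd => ?_
  · exact Finset.single_le_sum (f := fun k => (D (X k)).totalDegree + 1)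
      (fun _ _ => Nat.zero_le _) (Finset.mem_univ k)
  · exact homogeneousComponent_eq_zero _ _ (by simpa using hd)

end Decomposition

/-- for `n ≥ 2`, the smallest Lie subalgebra of `W(n)` containing
`S(n)_{[−1]} ∪ S(n)_{[0]} ∪ S(n)_{[1]}` is the special algebra
`S(n) = {D : div(D) = 0}`. -/
theorem stmt11 (F : Type*) [Field F] [CharZero F] (n : ℕ) (hn : 2 ≤ n) :
    (LieSubalgebra.lieSpan F (Wn F n)
      (Sgr F n (-1) ∪ Sgr F n 0 ∪ Sgr F n 1) : Set (Wn F n)) =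
    {D : Wn F n | divg D = 0} := by
  set L := LieSubalgebra.lieSpan F (Wn F n) (Sgr F n (-1) ∪ Sgr F n 0 ∪ Sgr F n 1)
  apply Set.Subset.antisymm
  · have h : L ≤ specialSubalgebra F n := by
      refine LieSubalgebra.lieSpan_le.2 ?_
      rintro D ((hD | hD) | hD) <;> exact hD.1
    exact h
  · intro D hD
    have hsub : Sgr F n (-1) ∪ Sgr F n 0 ∪ Sgr F n 1 ⊆ (L : Set (Wn F n)) :=
      LieSubalgebra.subset_lieSpan
    have hL (i j : Fin n) (m : Fin n →₀ ℕ) (hm : m.degree ≤ 3) :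
        ham i j (monomial m (1 : F)) ∈ L := by
      have hhom : (monomial m (1 : F)).IsHomogeneous m.degree := isHomogeneous_monomial _ rfl
      generalize m.degree = e at hm hhom
      rcases e with _ | _ | _ | _ | e
      · have : ham i j (monomial m (1 : F)) = 0 := by
          rw [totalDegree_eq_zero_iff_eq_C.1 (Nat.le_zero.1 hhom.totalDegree_le)]
          ext1 k
          simp only [ham_apply, pderiv_C, zero_mul, sub_zero, Derivation.zero_apply]
        rw [this]
        exact L.zero_mem
      · exact hsub (Or.inl (Or.inl ⟨divg_ham _ _ _, by simpa using ham_mem_Wgr i j hhom⟩))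
      · exact hsub (Or.inl (Or.inr ⟨divg_ham _ _ _, by simpa using ham_mem_Wgr i j hhom⟩))
      · exact hsub (Or.inr ⟨divg_ham _ _ _, by
          have := ham_mem_Wgr i j hhom
          norm_num at this
          exact this⟩)
      · omega
    obtain ⟨M, hM⟩ := exists_sum_homPart D
    rw [hM]
    change _ ∈ L
    refine sum_mem fun d _ => ?_
    have hne : (n : F) + d - 1 ≠ 0 := by
      have h : ((n + d - 1 : ℕ) : F) = (n : F) + d - 1 := by
        rw [Nat.cast_sub (by omega)]
        push_cast
        rfl
      rw [← h, Nat.cast_ne_zero]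
      omega
    have h := sum_ham_X_mul (d := d) (D := homPart d D)
      (fun k => by rw [homPart_X]; exact homogeneousComponent_isHomogeneous _ _)
      (divg_homPart d hD)
    rw [← inv_smul_smul₀ hne (homPart d D), ← h]
    exact L.smul_mem _ (sum_mem fun i _ => sum_mem fun j _ => ham_mem hL i j _)
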